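/- For every nonnegative integer n, the set 𝒜_n is a modular set modulo 3^{2n+1} with |𝒜_n| = 2^{2n+1} and maximum element 2·3^{2n}. -/

import Mathlib

/-- `z` is mod-covered by `A` modulo `N`. -/
def ModCovered (N : ℕ) (A : Set ℕ) (z : ℤ) : Prop :=
  ∃ x ∈ A, ∃ y ∈ A, x ≤ y ∧ 2 * (y : ℤ) - (x : ℤ) ≡ z [ZMOD (N : ℤ)]

/-- `A` is 3-free modulo `N`: any mod-AP in `A` is trivial. -/
def ThreeFreeMod (N : ℕ) (A : Set ℕ) : Prop :=
  ∀ x ∈ A, ∀ y ∈ A, ∀ z ∈ A,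
    ((x : ℤ) + (z : ℤ) ≡ 2 * (y : ℤ) [ZMOD (N : ℤ)]) → x = y ∧ y = z

/-- `A` is a near-modular set modulo `N`. -/
def NearModular (N : ℕ) (A : Finset ℕ) : Prop :=
  0 ∈ A ∧ ThreeFreeMod N ↑A ∧ ∀ z : ℤ, ModCovered N ↑A z

/-- `A` is a modular set modulo `N`: near-modular and contained in `{0, …, N-1}`. -/
def ModularSet (N : ℕ) (A : Finset ℕ) : Prop :=
  NearModular N A ∧ ∀ a ∈ A, a < N

/-- `T 0 = {0}` and `T (n+1) = {0, 1, 6, 7} + 9 · T n`. -/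
def Tset : ℕ → Finset ℕ
  | 0 => {0}
  | n + 1 => Finset.image₂ (fun d x => d + 9 * x) ({0, 1, 6, 7} : Finset ℕ) (Tset n)

/-- `𝒜 n = ((T n ∪ (T n + 3^(2n))) \ {3^(2n)}) ∪ {2 · 3^(2n)}`. -/
def Aset (n : ℕ) : Finset ℕ :=
  ((Tset n ∪ (Tset n).image (fun x => x + 3 ^ (2 * n))) \ {3 ^ (2 * n)})
    ∪ {2 * 3 ^ (2 * n)}

theorem mem_Tset_succ {n x : ℕ} :
    x ∈ Tset (n + 1) ↔
      ∃ d u, (d = 0 ∨ d = 1 ∨ d = 6 ∨ d = 7) ∧ u ∈ Tset n ∧ x = d + 9 * u := by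
  simp only [Tset, Finset.mem_image₂, Finset.mem_insert, Finset.mem_singleton]
  constructor
  · rintro ⟨d, hd, u, hu, rfl⟩
    exact ⟨d, u, hd, hu, rfl⟩
  · rintro ⟨d, u, hd, hu, rfl⟩
    exact ⟨d, hd, u, hu, rfl⟩

theorem add_nine_mul_mem_Tset {n d u : ℕ} (hd : d = 0 ∨ d = 1 ∨ d = 6 ∨ d = 7)
    (hu : u ∈ Tset n) : d + 9 * u ∈ Tset (n + 1) :=
  mem_Tset_succ.2 ⟨d, u, hd, hu, rfl⟩

theorem zero_mem_Tset (n : ℕ) : 0 ∈ Tset n := by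
  induction n with
  | zero => simp [Tset]
  | succ n ih => simpa using add_nine_mul_mem_Tset (Or.inl rfl) ih

theorem lt_of_mem_Tset {n x : ℕ} (hx : x ∈ Tset n) : x < 9 ^ n := by
  induction n generalizing x with
  | zero => simp_all [Tset]
  | succ n ih =>
    obtain ⟨d, u, hd, hu, rfl⟩ := mem_Tset_succ.1 hx
    have := ih hu
    rw [pow_succ]
    omega

theorem card_Tset (n : ℕ) : (Tset n).card = 4 ^ n := by
  induction n with
  | zero => simp [Tset]
  | succ n ih =>
    rw [Tset, Finset.card_image₂_iff.2, ih, pow_succ]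
    · simp [mul_comm]
    · rintro ⟨a, u⟩ ha ⟨b, v⟩ hb h
      simp only [Set.mem_prod, Finset.mem_coe, Finset.mem_insert, Finset.mem_singleton] at ha hb
      simp only [Prod.mk.injEq] at h ⊢
      omega

/-- `Tset n` is 3-free modulo `9 ^ n`. -/
theorem eq_of_add_eq_two_mul_of_mem_Tset {n x y z : ℕ} (hx : x ∈ Tset n) (hy : y ∈ Tset n)
    (hz : z ∈ Tset n) {k : ℤ} (h : (x : ℤ) + z = 2 * y + 9 ^ n * k) : x = y ∧ y = z := by
  induction n generalizing x y z with
  | zero => simp_all [Tset]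
  | succ n ih =>
    obtain ⟨a, u, ha, hu, rfl⟩ := mem_Tset_succ.1 hx
    obtain ⟨b, v, hb, hv, rfl⟩ := mem_Tset_succ.1 hy
    obtain ⟨c, w, hc, hw, rfl⟩ := mem_Tset_succ.1 hz
    have h' : (a : ℤ) + 9 * u + (c + 9 * w) = 2 * (b + 9 * v) + 9 * (9 ^ n * k) := by
      push_cast at h
      rw [h]
      ring
    have habc : a = b ∧ b = c := by omega
    have := ih hu hv hw (by omega)
    omega

/-- Every integer is mod-covered by `Tset n` modulo `9 ^ n`. -/
theorem exists_Tset_cover (n : ℕ) (z : ℤ) :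
    ∃ s ∈ Tset n, ∃ t ∈ Tset n, s ≤ t ∧ ∃ k : ℤ, z = 2 * t - s + 9 ^ n * k := by
  induction n generalizing z with
  | zero => exact ⟨0, zero_mem_Tset 0, 0, zero_mem_Tset 0, le_rfl, z, by simp⟩
  | succ n ih =>
    have hdigit : ∃ d e : ℕ, (d = 0 ∨ d = 1 ∨ d = 6 ∨ d = 7) ∧
        (e = 0 ∨ e = 1 ∨ e = 6 ∨ e = 7) ∧ d ≤ e ∧ ∃ w : ℤ, z = 2 * e - d + 9 * w := by
      have hz := Int.emod_add_mul_ediv z 9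
      have h0 := Int.emod_nonneg z (b := 9) (by norm_num)
      have h9 := Int.emod_lt_of_pos z (b := 9) (by norm_num)
      have key : ∃ d e : ℕ, (d = 0 ∨ d = 1 ∨ d = 6 ∨ d = 7) ∧
          (e = 0 ∨ e = 1 ∨ e = 6 ∨ e = 7) ∧ d ≤ e ∧ (2 * (e : ℤ) - d - z % 9) % 9 = 0 := by
        generalize z % 9 = r at h0 h9
        interval_cases r
        · exact ⟨0, 0, by norm_num⟩
        · exact ⟨1, 1, by norm_num⟩
        · exact ⟨0, 1, by norm_num⟩
        · exact ⟨0, 6, by norm_num⟩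
        · exact ⟨1, 7, by norm_num⟩
        · exact ⟨0, 7, by norm_num⟩
        · exact ⟨6, 6, by norm_num⟩
        · exact ⟨7, 7, by norm_num⟩
        · exact ⟨6, 7, by norm_num⟩
      obtain ⟨d, e, hd, he, hde, h⟩ := key
      exact ⟨d, e, hd, he, hde, (z - (2 * e - d)) / 9, by omega⟩
    obtain ⟨d, e, hd, he, hde, w, hw⟩ := hdigit
    obtain ⟨s, hs, t, ht, hst, k, hk⟩ := ih w
    refine ⟨d + 9 * s, add_nine_mul_mem_Tset hd hs, e + 9 * t, add_nine_mul_mem_Tset he ht,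
      by omega, k, ?_⟩
    rw [hw, hk]
    push_cast
    ring

/-- The refinement of `exists_Tset_cover` modulo `3 * 9 ^ n`. -/
theorem exists_Tset_cover_add (n : ℕ) (z : ℤ) :
    ∃ s ∈ Tset n, ∃ t ∈ Tset n, s ≤ t ∧ ∃ c : ℤ, (c = 0 ∨ c = 1 ∨ c = 2) ∧
      ∃ k : ℤ, z = 2 * t - s + 9 ^ n * c + 3 * 9 ^ n * k := by
  obtain ⟨s, hs, t, ht, hst, k, hk⟩ := exists_Tset_cover n z
  refine ⟨s, hs, t, ht, hst, k % 3, by omega, k / 3, ?_⟩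
  conv_lhs => rw [hk, ← Int.emod_add_mul_ediv k 3]
  ring

theorem mem_Aset_iff {n x : ℕ} :
    x ∈ Aset n ↔ x ∈ Tset n ∨ (∃ t ∈ Tset n, t ≠ 0 ∧ x = t + 9 ^ n) ∨ x = 2 * 9 ^ n := by
  have h9 : 3 ^ (2 * n) = 9 ^ n := by rw [pow_mul]; norm_num
  simp only [Aset, h9, Finset.mem_union, Finset.mem_sdiff, Finset.mem_image,
    Finset.mem_singleton]
  constructor
  · rintro (⟨h | ⟨t, ht, rfl⟩, hx⟩ | h)
    · exact Or.inl h
    · exact Or.inr (Or.inl ⟨t, ht, by omega, rfl⟩)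
    · exact Or.inr (Or.inr h)
  · rintro (h | ⟨t, ht, ht0, rfl⟩ | h)
    · exact Or.inl ⟨Or.inl h, (lt_of_mem_Tset h).ne⟩
    · exact Or.inl ⟨Or.inr ⟨t, ht, rfl⟩, by omega⟩
    · exact Or.inr h

/-- The elements of `Aset n` other than `2 * 9 ^ n`. -/
def IsLowerPart (n x : ℕ) : Prop :=
  x ∈ Tset n ∨ ∃ t ∈ Tset n, t ≠ 0 ∧ x = t + 9 ^ n

theorem IsLowerPart.mem_Aset {n x : ℕ} (h : IsLowerPart n x) : x ∈ Aset n :=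
  mem_Aset_iff.2 (h.imp_right Or.inl)

theorem IsLowerPart.nine_mul {n x : ℕ} (h : IsLowerPart n x) :
    IsLowerPart (n + 1) (9 * x) := by
  rcases h with h | ⟨t, ht, ht0, rfl⟩
  · exact Or.inl (by simpa using add_nine_mul_mem_Tset (Or.inl rfl) h)
  · exact Or.inr ⟨9 * t, by simpa using add_nine_mul_mem_Tset (Or.inl rfl) ht, by omega,
      by rw [pow_succ]; ring⟩

theorem IsLowerPart.add_nine_mul {n d x : ℕ} (hd : d = 0 ∨ d = 1 ∨ d = 6 ∨ d = 7)
    (h : IsLowerPart n x) : IsLowerPart (n + 1) (d + 9 * x) := by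
  rcases h with h | ⟨t, ht, ht0, rfl⟩
  · exact Or.inl (add_nine_mul_mem_Tset hd h)
  · exact Or.inr ⟨d + 9 * t, add_nine_mul_mem_Tset hd ht, by omega, by rw [pow_succ]; ring⟩

/-- Nonzero `s ≤ t` in `Tset n` cover all three lifts of `2 * t - s` modulo `3 * 9 ^ n`. -/
theorem exists_lowerPart_cover_of_ne_zero {n s t : ℕ} (hs : s ∈ Tset n) (ht : t ∈ Tset n)
    (hst : s ≤ t) (hs0 : s ≠ 0) {c : ℤ} (hc : c = 0 ∨ c = 1 ∨ c = 2) :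
    ∃ x y, IsLowerPart n x ∧ IsLowerPart n y ∧ x ≤ y ∧
      2 * (y : ℤ) - x = 2 * t - s + 9 ^ n * c := by
  have ht' : IsLowerPart n (t + 9 ^ n) := Or.inr ⟨t, ht, by omega, rfl⟩
  rcases hc with rfl | rfl | rfl
  · exact ⟨s, t, Or.inl hs, Or.inl ht, hst, by ring⟩
  · exact ⟨s + 9 ^ n, t + 9 ^ n, Or.inr ⟨s, hs, hs0, rfl⟩, ht', by omega, by push_cast; ring⟩
  · exact ⟨s, t + 9 ^ n, Or.inl hs, ht', hst.trans (Nat.le_add_right _ _), by push_cast; ring⟩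

theorem exists_lowerPart_cover (n : ℕ) {t : ℕ} (ht : t ∈ Tset n) (ht0 : t ≠ 0) :
    (∃ x y, IsLowerPart n x ∧ IsLowerPart n y ∧ x ≤ y ∧
      ∃ k : ℤ, 2 * (t : ℤ) + 9 ^ n = 2 * y - x + 3 * 9 ^ n * k) ∨ 3 * t = 2 * 9 ^ n := by
  induction n generalizing t with
  | zero => simp_all [Tset]
  | succ n ih =>
    obtain ⟨e, u, he, hu, rfl⟩ := mem_Tset_succ.1 ht
    by_cases he0 : e = 0
    · subst he0
      rcases ih hu (by omega) with ⟨x, y, hx, hy, hxy, k, hk⟩ | h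
      · refine Or.inl ⟨9 * x, 9 * y, hx.nine_mul, hy.nine_mul, by omega, k, ?_⟩
        push_cast
        linear_combination 9 * hk
      · right
        rw [pow_succ]
        omega
    by_cases he1 : e = 1
    · subst he1
      left
      obtain ⟨s, hs, t, ht, hst, c, hc, k, hk⟩ :=
        exists_Tset_cover_add n (2 * (u : ℤ) - 1 + 9 ^ n)
      obtain ⟨x, y, hx, hy, hxy, h⟩ := exists_lowerPart_cover_of_ne_zero
        (add_nine_mul_mem_Tset (d := 1) (by norm_num) hs)
        (add_nine_mul_mem_Tset (d := 6) (by norm_num) ht) (by omega) (by omega) hc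
      refine ⟨x, y, hx, hy, hxy, k, ?_⟩
      rw [h]
      push_cast
      linear_combination 9 * hk
    by_cases hu' : u ≠ 0 ∧ 3 * u ≠ 2 * 9 ^ n
    · rcases ih hu hu'.1 with ⟨x, y, hx, hy, hxy, k, hk⟩ | h
      · refine Or.inl ⟨9 * x, e + 9 * y, hx.nine_mul, hy.add_nine_mul he, by omega, k, ?_⟩
        push_cast
        linear_combination 9 * hk
      · exact absurd h hu'.2
    cases n with
    | zero =>
      obtain rfl : u = 0 := by simpa [Tset] using hu
      obtain rfl | rfl : e = 6 ∨ e = 7 := by omega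
      · right; norm_num
      · exact Or.inl ⟨7, 15, Or.inl (add_nine_mul_mem_Tset (d := 7) (by norm_num) hu),
          Or.inr ⟨6, add_nine_mul_mem_Tset (d := 6) (by norm_num) hu, by norm_num⟩,
          by norm_num, 0, by norm_num⟩
    | succ m =>
      have hu1 : u + 1 ∈ Tset (m + 1) := by
        obtain ⟨d, v, hd, hv, rfl⟩ := mem_Tset_succ.1 hu
        have : d = 0 ∨ d = 6 := by
          rw [pow_succ] at hu'
          omega
        rw [show d + 9 * v + 1 = (d + 1) + 9 * v by ring]
        exact add_nine_mul_mem_Tset (by omega) hv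
      have h6 := add_nine_mul_mem_Tset (d := 6) (by norm_num) (zero_mem_Tset (m + 1))
      have hy := add_nine_mul_mem_Tset (d := e - 6) (by omega) hu1
      refine Or.inl ⟨6 + 9 * 0 + 9 ^ (m + 2), e - 6 + 9 * (u + 1) + 9 ^ (m + 2),
        Or.inr ⟨_, h6, by omega, rfl⟩, Or.inr ⟨_, hy, by omega, rfl⟩, by omega, 0, ?_⟩
      have : ((e - 6 : ℕ) : ℤ) = e - 6 := by omega
      push_cast [this]
      ring

theorem card_Aset (n : ℕ) : (Aset n).card = 2 ^ (2 * n + 1) := by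
  have hA : Aset n = insert (2 * 9 ^ n)
      (Tset n ∪ ((Tset n).erase 0).image (fun t => t + 9 ^ n)) := by
    ext x
    simp only [mem_Aset_iff, Finset.mem_insert, Finset.mem_union, Finset.mem_image,
      Finset.mem_erase]
    grind
  have h4 : 2 ^ (2 * n + 1) = 4 ^ n + 4 ^ n := by
    rw [pow_succ, pow_mul]
    norm_num
    ring
  have hpos : 0 < 4 ^ n := by positivity
  rw [hA, Finset.card_insert_of_notMem, Finset.card_union_of_disjoint,
    Finset.card_image_of_injective _ (add_left_injective _),
    Finset.card_erase_of_mem (zero_mem_Tset n), card_Tset, h4]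
  · omega
  · rw [Finset.disjoint_left]
    intro x hx hx'
    obtain ⟨t, -, rfl⟩ := Finset.mem_image.1 hx'
    have := lt_of_mem_Tset hx
    omega
  · intro h
    simp only [Finset.mem_union, Finset.mem_image, Finset.mem_erase] at h
    rcases h with h | ⟨t, ⟨-, ht⟩, h⟩
    · have := lt_of_mem_Tset h
      omega
    · have := lt_of_mem_Tset ht
      omega

theorem exists_eq_add_mul_of_mem_Aset {n x : ℕ} (hx : x ∈ Aset n) :
    ∃ t ∈ Tset n, ∃ a : ℕ, (a = 0 ∨ a = 1 ∧ t ≠ 0 ∨ a = 2 ∧ t = 0) ∧ x = t + 9 ^ n * a := by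
  rcases mem_Aset_iff.1 hx with h | ⟨t, ht, ht0, rfl⟩ | rfl
  · exact ⟨x, h, 0, by simp⟩
  · exact ⟨t, ht, 1, by simp [ht0]⟩
  · exact ⟨0, zero_mem_Tset n, 2, by simp [mul_comm]⟩

theorem threeFreeMod_Aset (n : ℕ) : ThreeFreeMod (3 * 9 ^ n) (Aset n) := by
  intro x hx y hy z hz h
  obtain ⟨r, hr, a, ha, rfl⟩ := exists_eq_add_mul_of_mem_Aset hx
  obtain ⟨s, hs, b, hb, rfl⟩ := exists_eq_add_mul_of_mem_Aset hy
  obtain ⟨t, ht, c, hc, rfl⟩ := exists_eq_add_mul_of_mem_Aset hz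
  obtain ⟨k, hk⟩ := h.symm.dvd
  push_cast at hk
  obtain ⟨rfl, rfl⟩ := eq_of_add_eq_two_mul_of_mem_Tset hr hs ht
    (k := 3 * k + 2 * b - a - c) (by linear_combination hk)
  have hpos : (9 : ℤ) ^ n ≠ 0 := by positivity
  have habc : (a : ℤ) + c - 2 * b = 3 * k :=
    mul_left_cancel₀ hpos (by linear_combination hk)
  obtain ⟨rfl, rfl⟩ : a = b ∧ b = c := by omega
  exact ⟨rfl, rfl⟩

theorem modCovered_Aset (n : ℕ) (z : ℤ) : ModCovered (3 * 9 ^ n) (Aset n) z := by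
  suffices h : ∃ x ∈ Aset n, ∃ y ∈ Aset n, x ≤ y ∧
      ∃ k : ℤ, z = 2 * y - x + 3 * 9 ^ n * k by
    obtain ⟨x, hx, y, hy, hxy, k, hk⟩ := h
    refine ⟨x, hx, y, hy, hxy, Int.modEq_iff_dvd.2 ⟨k, ?_⟩⟩
    push_cast
    linear_combination hk
  obtain ⟨s, hs, t, ht, hst, c, hc, k, rfl⟩ := exists_Tset_cover_add n z
  have h0 : 0 ∈ Aset n := mem_Aset_iff.2 (Or.inl (zero_mem_Tset n))
  have htop : 2 * 9 ^ n ∈ Aset n := mem_Aset_iff.2 (Or.inr (Or.inr rfl))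
  by_cases hs0 : s = 0
  · subst hs0
    by_cases ht0 : t = 0
    · subst ht0
      rcases hc with rfl | rfl | rfl
      · exact ⟨0, h0, 0, h0, le_rfl, k, by push_cast; ring⟩
      · exact ⟨0, h0, _, htop, Nat.zero_le _, k - 1, by push_cast; ring⟩
      · exact ⟨_, htop, _, htop, le_rfl, k, by push_cast; ring⟩
    have ht' : t + 9 ^ n ∈ Aset n := mem_Aset_iff.2 (Or.inr (Or.inl ⟨t, ht, ht0, rfl⟩))
    rcases hc with rfl | rfl | rfl
    · exact ⟨0, h0, t, mem_Aset_iff.2 (Or.inl ht), hst, k, by push_cast; ring⟩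
    · rcases exists_lowerPart_cover n ht ht0 with ⟨x, y, hx, hy, hxy, l, hl⟩ | h
      · exact ⟨x, hx.mem_Aset, y, hy.mem_Aset, hxy, k + l,
          by push_cast; linear_combination hl⟩
      · refine ⟨_, ht', _, htop, by omega, k, ?_⟩
        have h' : 3 * (t : ℤ) = 2 * 9 ^ n := by exact_mod_cast h
        push_cast
        linear_combination h'
    · exact ⟨0, h0, _, ht', Nat.zero_le _, k, by push_cast; ring⟩
  · obtain ⟨x, y, hx, hy, hxy, h⟩ := exists_lowerPart_cover_of_ne_zero hs ht hst hs0 hc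
    exact ⟨x, hx.mem_Aset, y, hy.mem_Aset, hxy, k, by rw [h]⟩

theorem le_of_mem_Aset {n x : ℕ} (hx : x ∈ Aset n) : x ≤ 2 * 9 ^ n := by
  rcases mem_Aset_iff.1 hx with h | ⟨t, ht, -, rfl⟩ | rfl
  · have := lt_of_mem_Tset h
    omega
  · have := lt_of_mem_Tset ht
    omega
  · exact le_rfl

theorem Aset_modular (n : ℕ) :
    ModularSet (3 ^ (2 * n + 1)) (Aset n) ∧ (Aset n).card = 2 ^ (2 * n + 1) ∧
    ∃ h : (Aset n).Nonempty, (Aset n).max' h = 2 * 3 ^ (2 * n) := by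
  have h9 : 3 ^ (2 * n) = 9 ^ n := by rw [pow_mul]; norm_num
  have hpos : 0 < 9 ^ n := by positivity
  have htop : 2 * 9 ^ n ∈ Aset n := mem_Aset_iff.2 (Or.inr (Or.inr rfl))
  rw [pow_succ, h9, mul_comm _ 3]
  refine ⟨⟨⟨mem_Aset_iff.2 (Or.inl (zero_mem_Tset n)), threeFreeMod_Aset n,
    modCovered_Aset n⟩, fun a ha => ?_⟩, card_Aset n, ⟨_, htop⟩, ?_⟩
  · have := le_of_mem_Aset ha
    omega
  · exact le_antisymm (Finset.max'_le _ _ _ fun x => le_of_mem_Aset)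
      (Finset.le_max' _ _ htop)
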